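/- For every s ≥ 1, the Minkowski sum (K(b^s,1,1) ∪ K(b^s,1,2)) + K(c^s,1,1) is exactly the closed interval [ [0; b^s, 1, 1, \overline{3,1}] + [0; c^s, 1, 1, \overline{3,1}] , [0; b^s, 1, 2, \overline{1,3}] + [0; c^s, 1, 1, \overline{1,3}] ]. -/

import Mathlib

open Filter Set
open scoped Pointwise

noncomputable section

/-- The `n`-th convergent of the continued fraction `[0; a 0, a 1, a 2, …]`. -/
def cfConv : ℕ → (ℕ → ℕ) → ℝ
  | 0, _ => 0
  | n + 1, a => 1 / (a 0 + cfConv n fun i => a (i + 1))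

/-- The value `[0; a 0, a 1, a 2, …]` of the infinite continued fraction with
partial quotients `a 0, a 1, …` (the limit of its convergents). -/
def cfVal (a : ℕ → ℕ) : ℝ := limUnder atTop fun n => cfConv n a

/-- The sequence of partial quotients obtained by concatenating the finite word `b`
with the sequence `θ`. -/
def app (b : List ℕ) (θ : ℕ → ℕ) : ℕ → ℕ := fun n =>
  if h : n < b.length then b.get ⟨n, h⟩ else θ (n - b.length)

/-- The forbidden pairs of consecutive partial quotients. -/
def badPairs : Set (ℕ × ℕ) := {(1, 4), (2, 4)}

/-- The set `D` of sequences with entries in `{1,2,3,4}` avoiding the pairs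
`(1,4)` and `(2,4)`. -/
def Dset : Set (ℕ → ℕ) :=
  {θ | (∀ n, θ n ∈ ({1, 2, 3, 4} : Set ℕ)) ∧ ∀ n, (θ n, θ (n + 1)) ∉ badPairs}

/-- The Cantor set `K(b) = {[0; b, θ] : θ ∈ D, (b_s, θ_1) ∉ {(1,4),(2,4)}}`. -/
def Kb (b : List ℕ) : Set ℝ :=
  {x | ∃ θ ∈ Dset, (∀ d, b.getLast? = some d → (d, θ 0) ∉ badPairs) ∧
    x = cfVal (app b θ)}

/-- The set `K̃(b) ⊆ K(b)` of values `[0; b, θ]` with moreover `(θ_1, θ_2) ≠ (1,3)`. -/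
def Ktil (b : List ℕ) : Set ℝ :=
  {x | ∃ θ ∈ Dset, (∀ d, b.getLast? = some d → (d, θ 0) ∉ badPairs) ∧
    (θ 0, θ 1) ≠ (1, 3) ∧ x = cfVal (app b θ)}

/-- The word `b^s = (1,4)_s`. -/
def bW (s : ℕ) : List ℕ := (List.replicate s [1, 4]).flatten

/-- The word `c^s = (1,4)_{s-1}, 1, 3`. -/
def cW (s : ℕ) : List ℕ := bW (s - 1) ++ [1, 3]

/-- The periodic sequence `\overline{1,3}`. -/
def per13 : ℕ → ℕ := fun n => if n % 2 = 0 then 1 else 3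

/-- The periodic sequence `\overline{3,1}`. -/
def per31 : ℕ → ℕ := fun n => if n % 2 = 0 then 3 else 1

/-- Sequences of partial quotients with all entries in `{1, 2, 3, 4}`. -/
def ValidSeq (a : ℕ → ℕ) : Prop := ∀ n, 1 ≤ a n ∧ a n ≤ 4

lemma ValidSeq.tail {a : ℕ → ℕ} (ha : ValidSeq a) : ValidSeq fun i => a (i + 1) :=
  fun n => ha (n + 1)

lemma ValidSeq.one_le_cast {a : ℕ → ℕ} (ha : ValidSeq a) (n : ℕ) : (1 : ℝ) ≤ a n := by
  exact_mod_cast (ha n).1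

lemma ValidSeq.cast_le_four {a : ℕ → ℕ} (ha : ValidSeq a) (n : ℕ) : (a n : ℝ) ≤ 4 := by
  exact_mod_cast (ha n).2

lemma cfConv_succ_mem {a : ℕ → ℕ} (ha : ValidSeq a) (n : ℕ) :
    cfConv (n + 1) a ∈ Icc (1 / 5 : ℝ) 1 := by
  induction n generalizing a with
  | zero =>
    have h1 := ha.one_le_cast 0
    have h2 := ha.cast_le_four 0
    simp only [cfConv, mem_Icc]
    constructor
    · apply one_div_le_one_div_of_le <;> linarith
    · rw [div_le_one] <;> linarith
  | succ n ih =>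
    have h1 := ha.one_le_cast 0
    have h2 := ha.cast_le_four 0
    obtain ⟨h3, h4⟩ := ih ha.tail
    rw [cfConv]
    constructor
    · apply one_div_le_one_div_of_le <;> linarith
    · rw [div_le_one] <;> linarith

lemma abs_one_div_add_sub_le {d x y : ℝ} (hd : 1 ≤ d) (hx : 1 / 5 ≤ x) (hy : 1 / 5 ≤ y) :
    |1 / (d + x) - 1 / (d + y)| ≤ 25 / 36 * |x - y| := by
  have h : 1 / (d + x) - 1 / (d + y) = (y - x) / ((d + x) * (d + y)) := by
    have : d + x ≠ 0 := by linarith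
    have : d + y ≠ 0 := by linarith
    field_simp
    ring
  have hp : (36 / 25 : ℝ) ≤ (d + x) * (d + y) := by nlinarith
  rw [h, abs_div, abs_of_pos (by linarith : (0 : ℝ) < (d + x) * (d + y)), abs_sub_comm,
    div_le_iff₀ (by linarith)]
  nlinarith [abs_nonneg (x - y)]

lemma dist_cfConv_succ_le {a : ℕ → ℕ} (ha : ValidSeq a) (n : ℕ) :
    dist (cfConv (n + 1) a) (cfConv (n + 2) a) ≤ 1 * (25 / 36 : ℝ) ^ n := by
  induction n generalizing a with
  | zero =>
    obtain ⟨h1, h2⟩ := cfConv_succ_mem ha 0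
    obtain ⟨h3, h4⟩ := cfConv_succ_mem ha 1
    rw [Real.dist_eq, abs_le]
    constructor <;> norm_num at * <;> linarith
  | succ n ih =>
    rw [cfConv, cfConv, Real.dist_eq]
    refine (abs_one_div_add_sub_le (ha.one_le_cast 0) (cfConv_succ_mem ha.tail n).1
      (cfConv_succ_mem ha.tail (n + 1)).1).trans ?_
    have := ih ha.tail
    rw [Real.dist_eq] at this
    rw [pow_succ]
    linarith

lemma tendsto_cfVal {a : ℕ → ℕ} (ha : ValidSeq a) :
    Tendsto (fun n => cfConv n a) atTop (nhds (cfVal a)) := by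
  apply tendsto_nhds_limUnder
  obtain ⟨l, hl⟩ := cauchySeq_tendsto_of_complete
    (cauchySeq_of_le_geometric (25 / 36 : ℝ) 1 (by norm_num) (dist_cfConv_succ_le ha))
  exact ⟨l, (tendsto_add_atTop_iff_nat 1).1 hl⟩

lemma cfVal_mem {a : ℕ → ℕ} (ha : ValidSeq a) : cfVal a ∈ Icc (1 / 5 : ℝ) 1 :=
  isClosed_Icc.mem_of_tendsto ((tendsto_add_atTop_iff_nat 1).2 (tendsto_cfVal ha))
    (Eventually.of_forall (cfConv_succ_mem ha))

lemma cfVal_eq {a : ℕ → ℕ} (ha : ValidSeq a) :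
    cfVal a = 1 / (a 0 + cfVal fun i => a (i + 1)) := by
  refine tendsto_nhds_unique ((tendsto_add_atTop_iff_nat 1).2 (tendsto_cfVal ha)) ?_
  have h1 := ha.one_le_cast 0
  have h2 := (cfVal_mem ha.tail).1
  exact tendsto_const_nhds.div ((tendsto_cfVal ha.tail).const_add (a 0 : ℝ)) (by linarith)

lemma abs_cfVal_sub_le {a b : ℕ → ℕ} (ha : ValidSeq a) (hb : ValidSeq b) (n : ℕ)
    (hab : ∀ i < n, a i = b i) : |cfVal a - cfVal b| ≤ (25 / 36 : ℝ) ^ n := by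
  induction n generalizing a b with
  | zero =>
    obtain ⟨h1, h2⟩ := cfVal_mem ha
    obtain ⟨h3, h4⟩ := cfVal_mem hb
    rw [abs_le, pow_zero]
    constructor <;> linarith
  | succ n ih =>
    rw [cfVal_eq ha, cfVal_eq hb, ← hab 0 n.succ_pos]
    refine (abs_one_div_add_sub_le (ha.one_le_cast 0) (cfVal_mem ha.tail).1
      (cfVal_mem hb.tail).1).trans ?_
    have := ih ha.tail hb.tail fun i hi => hab (i + 1) (by omega)
    rw [pow_succ]
    linarith

lemma continuousOn_cfVal : ContinuousOn cfVal {a | ValidSeq a} := by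
  intro a ha
  rw [ContinuousWithinAt, Metric.tendsto_nhds]
  intro ε hε
  obtain ⟨n, hn⟩ := exists_pow_lt_of_lt_one hε (by norm_num : (25 / 36 : ℝ) < 1)
  have hU : {b : ℕ → ℕ | ∀ i < n, b i = a i} ∈ nhds a := by
    have : {b : ℕ → ℕ | ∀ i < n, b i = a i} = (Set.Iio n).pi fun i => {a i} := by
      ext b
      simp [Set.pi]
    rw [this]
    exact set_pi_mem_nhds (Set.finite_Iio n) fun i _ => by simp
  filter_upwards [self_mem_nhdsWithin, mem_nhdsWithin_of_mem_nhds hU] with b hb hab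
  exact (abs_cfVal_sub_le hb ha n hab).trans_lt hn

lemma validSeq_of_mem_Dset {θ : ℕ → ℕ} (h : θ ∈ Dset) : ValidSeq θ := by
  intro n
  have := h.1 n
  simp only [mem_insert_iff, mem_singleton_iff] at this
  omega

/-- The values `[0; θ]` with `θ ∈ D` and `i ≤ θ 0 ≤ j`. -/
def Eset (i j : ℕ) : Set ℝ := cfVal '' {θ | θ ∈ Dset ∧ i ≤ θ 0 ∧ θ 0 ≤ j}

lemma isClosed_Dset : IsClosed Dset := by
  have h1 : IsClosed {θ : ℕ → ℕ | ∀ n, θ n ∈ ({1, 2, 3, 4} : Set ℕ)} := by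
    simp only [ofPred_forall]
    exact isClosed_iInter fun n =>
      (isClosed_discrete ({1, 2, 3, 4} : Set ℕ)).preimage (continuous_apply n)
  have h2 : IsClosed {θ : ℕ → ℕ | ∀ n, (θ n, θ (n + 1)) ∉ badPairs} := by
    simp only [ofPred_forall]
    refine isClosed_iInter fun n => ?_
    have hc : Continuous fun θ : ℕ → ℕ => (θ n, θ (n + 1)) :=
      (continuous_apply n).prodMk (continuous_apply (n + 1))
    exact (isClosed_discrete badPairsᶜ).preimage hc
  exact h1.inter h2

lemma isCompact_Eset (i j : ℕ) : IsCompact (Eset i j) := by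
  refine IsCompact.image_of_continuousOn ?_
    (continuousOn_cfVal.mono fun θ hθ => validSeq_of_mem_Dset hθ.1)
  have hc : IsCompact (Set.univ.pi fun _ : ℕ => ({1, 2, 3, 4} : Set ℕ)) :=
    isCompact_univ_pi fun _ => (Set.toFinite _).isCompact
  refine hc.of_isClosed_subset ?_ fun θ hθ n _ => hθ.1.1 n
  have hc0 : Continuous fun θ : ℕ → ℕ => θ 0 := continuous_apply 0
  exact isClosed_Dset.inter ((isClosed_discrete (Set.Icc i j)).preimage hc0)

lemma per13_mem : per13 ∈ Dset := by
  refine ⟨fun n => ?_, fun n => ?_⟩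
  · unfold per13
    split_ifs <;> simp
  · simp only [per13, badPairs, mem_insert_iff, mem_singleton_iff, Prod.mk.injEq]
    split_ifs <;> omega

lemma per31_mem : per31 ∈ Dset := by
  refine ⟨fun n => ?_, fun n => ?_⟩
  · unfold per31
    split_ifs <;> simp
  · simp only [per31, badPairs, mem_insert_iff, mem_singleton_iff, Prod.mk.injEq]
    split_ifs <;> omega

lemma tail_mem_Dset {θ : ℕ → ℕ} (h : θ ∈ Dset) : (fun i => θ (i + 1)) ∈ Dset :=
  ⟨fun n => h.1 (n + 1), fun n => h.2 (n + 1)⟩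

lemma cfVal_per13 : cfVal per13 = 1 / (1 + cfVal per31) := by
  rw [cfVal_eq (validSeq_of_mem_Dset per13_mem)]
  have h : (fun i => per13 (i + 1)) = per31 := by
    funext n
    simp only [per13, per31]
    split_ifs <;> omega
  rw [h]
  norm_num [per13]

lemma cfVal_per31 : cfVal per31 = 1 / (3 + cfVal per13) := by
  rw [cfVal_eq (validSeq_of_mem_Dset per31_mem)]
  have h : (fun i => per31 (i + 1)) = per13 := by
    funext n
    simp only [per13, per31]
    split_ifs <;> omega
  rw [h]
  norm_num [per31]

lemma cfVal_per13_bounds : cfVal per13 ∈ Icc (0.79128 : ℝ) 0.7913 := by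
  have h1 := cfVal_per13
  have h2 := cfVal_per31
  have h3 := (cfVal_mem (validSeq_of_mem_Dset per13_mem)).1
  have h4 := (cfVal_mem (validSeq_of_mem_Dset per31_mem)).1
  rw [eq_div_iff (by linarith)] at h1 h2
  have h5 : cfVal per13 ^ 2 + 3 * cfVal per13 = 3 := by nlinarith
  constructor <;> nlinarith

lemma cfVal_bounds_aux (n : ℕ) : ∀ θ ∈ Dset,
    cfVal θ ≤ cfVal per13 + (25 / 36 : ℝ) ^ n ∧
      (θ 0 ≤ 3 → cfVal per31 - (25 / 36 : ℝ) ^ n ≤ cfVal θ) := by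
  induction n with
  | zero =>
    intro θ hθ
    obtain ⟨h1, h2⟩ := cfVal_mem (validSeq_of_mem_Dset hθ)
    obtain ⟨h3, h4⟩ := cfVal_mem (validSeq_of_mem_Dset per13_mem)
    obtain ⟨h5, h6⟩ := cfVal_mem (validSeq_of_mem_Dset per31_mem)
    constructor
    · norm_num
      linarith
    · intro _
      norm_num
      linarith
  | succ n ih =>
    intro θ hθ
    have hv := validSeq_of_mem_Dset hθ
    obtain ⟨i1, i2⟩ := ih _ (tail_mem_Dset hθ)
    have ht := cfVal_mem hv.tail
    obtain ⟨h3, h4⟩ := cfVal_mem (validSeq_of_mem_Dset per13_mem)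
    obtain ⟨h5, h6⟩ := cfVal_mem (validSeq_of_mem_Dset per31_mem)
    have hε : (0 : ℝ) ≤ (25 / 36 : ℝ) ^ n := by positivity
    have hθ0 := hv.one_le_cast 0
    rw [cfVal_eq hv, pow_succ]
    set v := cfVal fun i => θ (i + 1)
    have hv1 : (1 / 5 : ℝ) ≤ v := ht.1
    constructor
    · rcases Nat.lt_or_ge 1 (θ 0) with h | h
      · have h' : (2 : ℝ) ≤ θ 0 := by exact_mod_cast h
        have : 1 / ((θ 0 : ℝ) + v) ≤ 1 / 2 :=
          one_div_le_one_div_of_le (by norm_num) (by linarith)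
        have h0 : (0.79128 : ℝ) ≤ cfVal per13 := cfVal_per13_bounds.1
        norm_num at h0
        linarith
      · have h0 : θ 0 = 1 := le_antisymm h (hv 0).1
        have hb : θ 1 ≤ 3 := by
          have hbad := hθ.2 0
          have := (hv 1).2
          simp only [badPairs, mem_insert_iff, mem_singleton_iff, Prod.mk.injEq, h0] at hbad
          norm_num at hbad
          omega
        have := i2 hb
        rw [h0, cfVal_per13]
        push_cast
        have hc := abs_one_div_add_sub_le (le_refl 1) hv1 h5
        rcases le_total (cfVal per31) v with hle | hle
        · have : 1 / (1 + v) ≤ 1 / (1 + cfVal per31) :=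
            one_div_le_one_div_of_le (by linarith) (by linarith)
          linarith
        · rw [abs_of_nonpos (sub_nonpos.2 hle)] at hc
          have := (abs_le.1 hc).2
          linarith
    · intro h
      have h' : (θ 0 : ℝ) ≤ 3 := by exact_mod_cast h
      have hm : 1 / (3 + v) ≤ 1 / ((θ 0 : ℝ) + v) :=
        one_div_le_one_div_of_le (by linarith) (by linarith)
      refine le_trans ?_ hm
      rw [cfVal_per31]
      have hc := abs_one_div_add_sub_le (by norm_num : (1 : ℝ) ≤ 3) h3 hv1
      rcases le_total v (cfVal per13) with hle | hle
      · have : 1 / (3 + cfVal per13) ≤ 1 / (3 + v) :=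
          one_div_le_one_div_of_le (by linarith) (by linarith)
        linarith
      · rw [abs_of_nonpos (sub_nonpos.2 hle)] at hc
        have := (abs_le.1 hc).2
        linarith

lemma tendsto_const_add_mul_pow (x t : ℝ) :
    Tendsto (fun n : ℕ => x + t * (25 / 36 : ℝ) ^ n) atTop (nhds x) := by
  simpa using ((tendsto_pow_atTop_nhds_zero_of_lt_one (by norm_num : (0 : ℝ) ≤ 25 / 36)
    (by norm_num)).const_mul t).const_add x

lemma cfVal_le_per13 {θ : ℕ → ℕ} (h : θ ∈ Dset) : cfVal θ ≤ cfVal per13 :=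
  ge_of_tendsto' (tendsto_const_add_mul_pow (cfVal per13) 1) fun n => by
    simpa using (cfVal_bounds_aux n θ h).1

/-- The minimum of the values `[0; θ]` with `θ ∈ D` and `θ 0 = d`. -/
def loEnd (d : ℕ) : ℝ := 1 / (d + cfVal per13)

/-- The largest digit allowed after the digit `d`. -/
def topDigit (d : ℕ) : ℕ := if d ≤ 2 then 3 else 4

/-- The maximum of the values `[0; θ]` with `θ ∈ D` and `θ 0 = d`. -/
def hiEnd (d : ℕ) : ℝ := 1 / (d + loEnd (topDigit d))

lemma loEnd_three : loEnd 3 = cfVal per31 := by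
  rw [cfVal_per31, loEnd]
  norm_num

lemma hiEnd_one : hiEnd 1 = cfVal per13 := by
  rw [cfVal_per13, hiEnd, ← loEnd_three]
  norm_num [topDigit]

lemma one_div_add_mem {d x l u k l' u' : ℝ} (h : x ∈ Icc l u) (hd : d = k) (hp : 0 < k + l)
    (h1 : l' * (k + u) ≤ 1) (h2 : 1 ≤ u' * (k + l)) : 1 / (d + x) ∈ Icc l' u' := by
  subst hd
  have hu : 0 < d + u := by linarith [h.1, h.2]
  have hx : 0 < d + x := by linarith [h.1]
  constructor
  · exact ((le_div_iff₀ hu).2 h1).trans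
      (one_div_le_one_div_of_le hx (by linarith [h.2]))
  · exact (one_div_le_one_div_of_le hp (by linarith [h.1])).trans ((div_le_iff₀ hp).2 h2)

lemma loEnd_one_mem : loEnd 1 ∈ Icc (0.5582 : ℝ) 0.5583 :=
  one_div_add_mem cfVal_per13_bounds Nat.cast_one (by norm_num) (by norm_num) (by norm_num)

lemma loEnd_two_mem : loEnd 2 ∈ Icc (0.3582 : ℝ) 0.3583 :=
  one_div_add_mem cfVal_per13_bounds (Nat.cast_ofNat (n := 2)) (by norm_num) (by norm_num)
    (by norm_num)

lemma loEnd_three_mem : loEnd 3 ∈ Icc (0.2637 : ℝ) 0.2638 :=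
  one_div_add_mem cfVal_per13_bounds (Nat.cast_ofNat (n := 3)) (by norm_num) (by norm_num)
    (by norm_num)

lemma loEnd_four_mem : loEnd 4 ∈ Icc (0.2087 : ℝ) 0.2088 :=
  one_div_add_mem cfVal_per13_bounds (Nat.cast_ofNat (n := 4)) (by norm_num) (by norm_num)
    (by norm_num)

lemma hiEnd_one_mem : hiEnd 1 ∈ Icc (0.7912 : ℝ) 0.7914 := by
  rw [hiEnd_one]
  exact Icc_subset_Icc (by norm_num) (by norm_num) cfVal_per13_bounds

lemma hiEnd_two_mem : hiEnd 2 ∈ Icc (0.4417 : ℝ) 0.4418 :=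
  one_div_add_mem loEnd_three_mem (Nat.cast_ofNat (n := 2)) (by norm_num) (by norm_num)
    (by norm_num)

lemma hiEnd_three_mem : hiEnd 3 ∈ Icc (0.3116 : ℝ) 0.3117 :=
  one_div_add_mem loEnd_four_mem (Nat.cast_ofNat (n := 3)) (by norm_num) (by norm_num)
    (by norm_num)

lemma hiEnd_four_mem : hiEnd 4 ∈ Icc (0.2375 : ℝ) 0.2377 :=
  one_div_add_mem loEnd_four_mem (Nat.cast_ofNat (n := 4)) (by norm_num) (by norm_num)
    (by norm_num)

lemma loEnd_anti {d e : ℕ} (h : d ≤ e) (hd : 1 ≤ d) : loEnd e ≤ loEnd d := by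
  have := cfVal_per13_bounds.1
  have h1 : (1 : ℝ) ≤ d := by exact_mod_cast hd
  have h2 : (d : ℝ) ≤ e := by exact_mod_cast h
  norm_num at this
  exact one_div_le_one_div_of_le (by linarith) (by linarith)

lemma hiEnd_anti {d e : ℕ} (h : d ≤ e) (hd : 1 ≤ d) (he : e ≤ 4) : hiEnd e ≤ hiEnd d := by
  have h1 := hiEnd_one_mem
  have h2 := hiEnd_two_mem
  have h3 := hiEnd_three_mem
  have h4 := hiEnd_four_mem
  norm_num at h1 h2 h3 h4
  interval_cases e <;> interval_cases d <;> first | exact le_refl _ | linarith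

lemma loEnd_nonneg (d : ℕ) : 0 ≤ loEnd d := by
  have := (cfVal_mem (validSeq_of_mem_Dset per13_mem)).1
  exact div_nonneg zero_le_one (by positivity)

lemma le_topDigit {θ : ℕ → ℕ} (h : θ ∈ Dset) : θ 1 ≤ topDigit (θ 0) := by
  have h1 := (validSeq_of_mem_Dset h 1).2
  have h2 := h.2 0
  have h3 := (validSeq_of_mem_Dset h 0).1
  simp only [badPairs, mem_insert_iff, mem_singleton_iff, Prod.mk.injEq, zero_add] at h2
  unfold topDigit
  split_ifs <;> omega

lemma loEnd_le_cfVal {θ : ℕ → ℕ} (h : θ ∈ Dset) : loEnd (θ 0) ≤ cfVal θ := by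
  have hv := validSeq_of_mem_Dset h
  have h1 := hv.one_le_cast 0
  have h2 := (cfVal_mem hv.tail).1
  rw [cfVal_eq hv]
  exact one_div_le_one_div_of_le (by linarith)
    (by linarith [cfVal_le_per13 (tail_mem_Dset h)])

lemma cfVal_le_hiEnd {θ : ℕ → ℕ} (h : θ ∈ Dset) : cfVal θ ≤ hiEnd (θ 0) := by
  have hv := validSeq_of_mem_Dset h
  have h1 := hv.one_le_cast 0
  rw [cfVal_eq hv]
  have ht := tail_mem_Dset h
  have h2 := (loEnd_anti (le_topDigit h) (hv 1).1).trans (loEnd_le_cfVal ht)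
  exact one_div_le_one_div_of_le (by linarith [loEnd_nonneg (topDigit (θ 0))]) (by linarith)

lemma Eset_subset {i j : ℕ} (hi : 1 ≤ i) : Eset i j ⊆ Icc (loEnd j) (hiEnd i) := by
  rintro _ ⟨θ, ⟨h, h1, h2⟩, rfl⟩
  have hv := validSeq_of_mem_Dset h 0
  exact ⟨(loEnd_anti h2 hv.1).trans (loEnd_le_cfVal h),
    (cfVal_le_hiEnd h).trans (hiEnd_anti h1 hi hv.2)⟩

lemma Eset_mono {i j i' j' : ℕ} (hi : i ≤ i') (hj : j' ≤ j) : Eset i' j' ⊆ Eset i j := by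
  rintro _ ⟨θ, ⟨h, h1, h2⟩, rfl⟩
  exact ⟨θ, ⟨h, hi.trans h1, h2.trans hj⟩, rfl⟩

/-- Prepend a digit to a sequence. -/
def consSeq (d : ℕ) (θ : ℕ → ℕ) : ℕ → ℕ
  | 0 => d
  | n + 1 => θ n

lemma validSeq_consSeq {d : ℕ} {θ : ℕ → ℕ} (hd : 1 ≤ d) (hd' : d ≤ 4) (h : ValidSeq θ) :
    ValidSeq (consSeq d θ) := by
  rintro (_ | n)
  · exact ⟨hd, hd'⟩
  · exact h n

lemma cfVal_consSeq {d : ℕ} {θ : ℕ → ℕ} (hd : 1 ≤ d) (hd' : d ≤ 4) (h : ValidSeq θ) :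
    cfVal (consSeq d θ) = 1 / (d + cfVal θ) :=
  cfVal_eq (validSeq_consSeq hd hd' h)

lemma one_div_add_mem_Eset {d : ℕ} (hd : 1 ≤ d) (hd' : d ≤ 4) {x : ℝ}
    (hx : x ∈ Eset 1 (topDigit d)) : 1 / (d + x) ∈ Eset d d := by
  obtain ⟨θ, ⟨h, h1, h2⟩, rfl⟩ := hx
  refine ⟨consSeq d θ, ⟨⟨?_, ?_⟩, le_refl d, le_refl d⟩,
    cfVal_consSeq hd hd' (validSeq_of_mem_Dset h)⟩
  · rintro (_ | n)
    · simp only [consSeq, mem_insert_iff, mem_singleton_iff]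
      omega
    · exact h.1 n
  · rintro (_ | n)
    · simp only [consSeq, badPairs, mem_insert_iff, mem_singleton_iff, Prod.mk.injEq]
      unfold topDigit at h2
      split_ifs at h2 <;> omega
    · exact h.2 n

lemma Eset_nonempty {i j : ℕ} (hi : i ≤ 3) (hj : 3 ≤ j) : (Eset i j).Nonempty :=
  ⟨_, per31, ⟨per31_mem, hi, hj⟩, rfl⟩

/-- If the sets `K n` form a binary tree of subsets of the intervals `[lo n, hi n]`, where each
split removes a gap that is at most as long as both remaining intervals and at least as long as
the gaps of both children, then two such sets whose gaps fit into each other's hulls have a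
Minkowski sum dense in the sum of the hulls. -/
lemma Icc_subset_closure_add {N : Type*} (K : N → Set ℝ) (lo hi gap : N → ℝ) {κ : ℝ}
    (hκ : 0 < κ) (hne : ∀ n, (K n).Nonempty) (hK : ∀ n, K n ⊆ Icc (lo n) (hi n))
    (hsplit : ∀ n, ∃ l r, K l ⊆ K n ∧ K r ⊆ K n ∧ lo l = lo n ∧ hi r = hi n ∧
      lo r - hi l = gap n ∧ gap n ≤ hi l - lo l ∧ gap n ≤ hi r - lo r ∧
      gap l ≤ gap n ∧ gap r ≤ gap n)
    (hgap : ∀ n, κ * (hi n - lo n) ≤ gap n) {n m : N}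
    (h1 : gap n ≤ hi m - lo m) (h2 : gap m ≤ hi n - lo n) :
    Icc (lo n + lo m) (hi n + hi m) ⊆ closure (K n + K m) := by
  have hlen : ∀ n, lo n ≤ hi n := fun n => by
    obtain ⟨a, ha⟩ := hne n
    exact (hK n ha).1.trans (hK n ha).2
  intro x hx
  rw [Metric.mem_closure_iff]
  intro ε hε
  suffices H : ∀ k : ℕ, ∀ n m, (hi n - lo n) + (hi m - lo m) ≤ k * (κ * (ε / 2)) →
      gap n ≤ hi m - lo m → gap m ≤ hi n - lo n → lo n + lo m ≤ x → x ≤ hi n + hi m →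
      ∃ a ∈ K n, ∃ b ∈ K m, |x - (a + b)| < ε by
    obtain ⟨k, hk⟩ := exists_nat_ge (((hi n - lo n) + (hi m - lo m)) / (κ * (ε / 2)))
    rw [div_le_iff₀ (by positivity)] at hk
    obtain ⟨a, ha, b, hb, hab⟩ := H k n m hk h1 h2 hx.1 hx.2
    exact ⟨a + b, Set.add_mem_add ha hb, hab⟩
  clear h1 h2 hx
  intro k
  induction k with
  | zero =>
    intro n m hl _ _ hx1 hx2
    obtain ⟨a, ha⟩ := hne n
    obtain ⟨b, hb⟩ := hne m
    have ha' := hK n ha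
    have hb' := hK m hb
    rw [mem_Icc] at ha' hb'
    refine ⟨a, ha, b, hb, abs_lt.2 ?_⟩
    norm_num at hl
    constructor <;> linarith
  | succ k ih =>
    intro n m hl h1 h2 hx1 hx2
    wlog hg : gap m ≤ gap n generalizing n m
    · obtain ⟨b, hb, a, ha, hab⟩ := this m n (by linarith) h2 h1 (by linarith) (by linarith)
        (le_of_not_ge hg)
      exact ⟨a, ha, b, hb, by rwa [add_comm a b]⟩
    by_cases hs : hi n - lo n < ε / 2 ∧ hi m - lo m < ε / 2
    · obtain ⟨a, ha⟩ := hne n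
      obtain ⟨b, hb⟩ := hne m
      have ha' := hK n ha
      have hb' := hK m hb
      rw [mem_Icc] at ha' hb'
      refine ⟨a, ha, b, hb, abs_lt.2 ?_⟩
      constructor <;> linarith
    · have hbig : κ * (ε / 2) ≤ gap n := by
        rw [not_and_or, not_lt, not_lt] at hs
        rcases hs with hs | hs
        · exact (mul_le_mul_of_nonneg_left hs hκ.le).trans (hgap n)
        · exact ((mul_le_mul_of_nonneg_left hs hκ.le).trans (hgap m)).trans hg
      obtain ⟨l, r, hKl, hKr, hlo, hhi, hmid, hgl, hgr, hll, hrr⟩ := hsplit n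
      have := hlen l
      have := hlen r
      push_cast at hl
      rcases le_total x (hi l + hi m) with hx | hx
      · obtain ⟨a, ha, b, hb, hab⟩ := ih l m (by linarith) (by linarith) (by linarith)
          (by linarith) hx
        exact ⟨a, hKl ha, b, hb, hab⟩
      · obtain ⟨a, ha, b, hb, hab⟩ := ih r m (by linarith) (by linarith) (by linarith)
          (by linarith) (by linarith)
        exact ⟨a, hKr ha, b, hb, hab⟩

/-- The length of the image of `[x, y]` under a Möbius map of determinant `±1` with
denominator `c + d t`. -/
def imgLen (c d x y : ℝ) : ℝ := (y - x) / ((c + d * x) * (c + d * y))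

lemma mul_imgLen_le {c d x y c' d' x' y' xl xu yl yu xl' xu' yl' yu' : ℝ} (k : ℝ)
    (hc : 0 < c) (hd : 0 ≤ d) (hc' : 0 < c') (hd' : 0 ≤ d')
    (hx : x ∈ Icc xl xu) (hy : y ∈ Icc yl yu) (hx' : x' ∈ Icc xl' xu') (hy' : y' ∈ Icc yl' yu')
    (hk : 0 ≤ k) (h0 : 0 ≤ xl) (h1 : xl ≤ yl) (h2 : 0 ≤ xl') (h4 : xu' ≤ yl')
    (h : k * (yu - xl) * ((c' + d' * xu') * (c' + d' * yu')) ≤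
      (yl' - xu') * ((c + d * xl) * (c + d * yl))) :
    k * imgLen c d x y ≤ imgLen c' d' x' y' := by
  rw [mem_Icc] at hx hy hx' hy'
  have p1 : 0 < c + d * xl := by positivity
  have p2 : c + d * xl ≤ c + d * x := by nlinarith
  have p3 : 0 < c + d * yl := by nlinarith
  have p4 : c + d * yl ≤ c + d * y := by nlinarith
  have q1 : 0 < c' + d' * x' := by nlinarith
  have q2 : c' + d' * x' ≤ c' + d' * xu' := by nlinarith
  have q3 : 0 < c' + d' * y' := by nlinarith
  have q4 : c' + d' * y' ≤ c' + d' * yu' := by nlinarith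
  have r1 : (c + d * xl) * (c + d * yl) ≤ (c + d * x) * (c + d * y) :=
    mul_le_mul p2 p4 p3.le (p1.le.trans p2)
  have r2 : (c' + d' * x') * (c' + d' * y') ≤ (c' + d' * xu') * (c' + d' * yu') :=
    mul_le_mul q2 q4 q3.le (q1.le.trans q2)
  have r3 : 0 < (c + d * x) * (c + d * y) := by nlinarith
  unfold imgLen
  rw [← mul_div_assoc, div_le_div_iff₀ r3 (by positivity)]
  calc k * (y - x) * ((c' + d' * x') * (c' + d' * y'))
      ≤ k * (yu - xl) * ((c' + d' * xu') * (c' + d' * yu')) := by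
        gcongr
        · exact mul_nonneg hk (by linarith)
        · linarith
        · linarith
    _ ≤ (yl' - xu') * ((c + d * xl) * (c + d * yl)) := h
    _ ≤ (y' - x') * ((c + d * x) * (c + d * y)) := by
        gcongr
        · linarith
        · linarith
        · linarith

lemma imgLen_le {c d x y c' d' x' y' xl xu yl yu xl' xu' yl' yu' : ℝ}
    (hc : 0 < c) (hd : 0 ≤ d) (hc' : 0 < c') (hd' : 0 ≤ d')
    (hx : x ∈ Icc xl xu) (hy : y ∈ Icc yl yu) (hx' : x' ∈ Icc xl' xu') (hy' : y' ∈ Icc yl' yu')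
    (h0 : 0 ≤ xl) (h1 : xl ≤ yl) (h2 : 0 ≤ xl') (h4 : xu' ≤ yl')
    (h : (yu - xl) * ((c' + d' * xu') * (c' + d' * yu')) ≤
      (yl' - xu') * ((c + d * xl) * (c + d * yl))) :
    imgLen c d x y ≤ imgLen c' d' x' y' := by
  have := mul_imgLen_le 1 hc hd hc' hd' hx hy hx' hy' zero_le_one h0 h1 h2 h4 (by linarith)
  rwa [one_mul] at this

/-- Coefficients of a Möbius map `x ↦ (a + b x) / (c + d x)` of determinant `±1`. -/
structure Moeb where
  a : ℝ
  b : ℝ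
  c : ℝ
  d : ℝ
  c_pos : 0 < c
  d_nonneg : 0 ≤ d
  d_le : d ≤ c
  det : b * c - a * d = 1 ∨ b * c - a * d = -1

namespace Moeb

variable (M : Moeb)

/-- The Möbius map itself. -/
def map (x : ℝ) : ℝ := (M.a + M.b * x) / (M.c + M.d * x)

/-- Composition with `x ↦ 1 / (n + x)`. -/
def ext (n : ℕ) (hn : 1 ≤ n) : Moeb where
  a := M.a * n + M.b
  b := M.a
  c := M.c * n + M.d
  d := M.c
  c_pos := by
    have := M.c_pos
    have := M.d_nonneg
    have : (1 : ℝ) ≤ n := by exact_mod_cast hn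
    positivity
  d_nonneg := M.c_pos.le
  d_le := by
    have := M.c_pos
    have := M.d_nonneg
    have : (1 : ℝ) ≤ n := by exact_mod_cast hn
    nlinarith
  det := by
    rcases M.det with h | h
    · right
      linarith
    · left
      linarith

lemma den_pos {x : ℝ} (hx : 0 ≤ x) : 0 < M.c + M.d * x := by
  have := M.c_pos
  have := M.d_nonneg
  positivity

lemma map_ext (n : ℕ) (hn : 1 ≤ n) {x : ℝ} (hx : 0 ≤ x) :
    (M.ext n hn).map x = M.map (1 / (n + x)) := by
  have h1 : (1 : ℝ) ≤ n := by exact_mod_cast hn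
  have h2 : (0 : ℝ) < n + x := by linarith
  have h3 := (M.ext n hn).den_pos hx
  have h4 := M.den_pos (one_div_pos.2 h2).le
  simp only [map, ext] at *
  rw [div_eq_div_iff h3.ne' h4.ne']
  field_simp
  ring

lemma map_sub {x y : ℝ} (hx : 0 ≤ x) (hy : 0 ≤ y) :
    M.map y - M.map x = (M.b * M.c - M.a * M.d) * imgLen M.c M.d x y := by
  have h1 := M.den_pos hx
  have h2 := M.den_pos hy
  rw [map, map, imgLen, div_sub_div _ _ h2.ne' h1.ne', ← mul_div_assoc,
    mul_comm (M.c + M.d * y) (M.c + M.d * x)]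
  congr 1
  ring

lemma imgLen_nonneg {x y : ℝ} (hx : 0 ≤ x) (hxy : x ≤ y) : 0 ≤ imgLen M.c M.d x y :=
  div_nonneg (sub_nonneg.2 hxy) (mul_pos (M.den_pos hx) (M.den_pos (hx.trans hxy))).le

lemma max_sub_min {x y : ℝ} (hx : 0 ≤ x) (hxy : x ≤ y) :
    max (M.map x) (M.map y) - min (M.map x) (M.map y) = imgLen M.c M.d x y := by
  have h1 := M.map_sub hx (hx.trans hxy)
  have h2 := M.imgLen_nonneg hx hxy
  rcases M.det with h | h
  · rw [h] at h1
    rw [max_eq_right (by linarith), min_eq_left (by linarith)]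
    linarith
  · rw [h] at h1
    rw [max_eq_left (by linarith), min_eq_right (by linarith)]
    linarith

lemma map_mem {x y z : ℝ} (hx : 0 ≤ x) (h1 : x ≤ z) (h2 : z ≤ y) :
    M.map z ∈ Icc (min (M.map x) (M.map y)) (max (M.map x) (M.map y)) := by
  have e1 := M.map_sub hx (hx.trans h1)
  have e2 := M.map_sub (hx.trans h1) ((hx.trans h1).trans h2)
  have l1 := M.imgLen_nonneg hx h1
  have l2 := M.imgLen_nonneg (hx.trans h1) h2
  rcases M.det with h | h
  · rw [h] at e1 e2
    exact ⟨(min_le_left _ _).trans (by linarith), le_trans (by linarith) (le_max_right _ _)⟩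
  · rw [h] at e1 e2
    exact ⟨(min_le_right _ _).trans (by linarith), le_trans (by linarith) (le_max_left _ _)⟩

lemma continuousOn_map : ContinuousOn M.map (Ici 0) := by
  unfold map
  refine ContinuousOn.div (by fun_prop) (by fun_prop) fun x hx => (M.den_pos hx).ne'

end Moeb

lemma hiEnd_nonneg (d : ℕ) : 0 ≤ hiEnd d := by
  have := loEnd_nonneg (topDigit d)
  unfold hiEnd
  positivity

lemma loEnd_le_hiEnd {i j : ℕ} (hi : 1 ≤ i) (hij : i ≤ j) (hj : j ≤ 4) :
    loEnd j ≤ hiEnd i := by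
  have h1 : loEnd j ≤ hiEnd j := by
    have a1 := loEnd_one_mem
    have a2 := loEnd_two_mem
    have a3 := loEnd_three_mem
    have a4 := loEnd_four_mem
    have b1 := hiEnd_one_mem
    have b2 := hiEnd_two_mem
    have b3 := hiEnd_three_mem
    have b4 := hiEnd_four_mem
    norm_num at a1 a2 a3 a4 b1 b2 b3 b4
    have : 1 ≤ j := hi.trans hij
    interval_cases j <;> linarith
  exact h1.trans (hiEnd_anti hij hi hj)

/-- A Möbius image of the part of the Cantor set whose first digit ranges over `i, …, j`. -/
structure Node where
  M : Moeb
  i : ℕ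
  j : ℕ
  one_le : 1 ≤ i
  lt : i < j
  three_le : 3 ≤ j
  le_four : j ≤ 4

namespace Node

/-- The Cantor set of a node. -/
def K (n : Node) : Set ℝ := n.M.map '' Eset n.i n.j

/-- The left end of the hull of a node. -/
def lo (n : Node) : ℝ := min (n.M.map (loEnd n.j)) (n.M.map (hiEnd n.i))

/-- The right end of the hull of a node. -/
def hi (n : Node) : ℝ := max (n.M.map (loEnd n.j)) (n.M.map (hiEnd n.i))

/-- The length of the gap between the smallest first digit and the others. -/
def gap (n : Node) : ℝ := imgLen n.M.c n.M.d (hiEnd (n.i + 1)) (loEnd n.i)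

/-- The gap length of the node representing the first digits `i, …, j` below `M`. -/
def pieceGap (M : Moeb) (i j : ℕ) : ℝ :=
  if i = j then imgLen (M.c * i + M.d) M.c (hiEnd 2) (loEnd 1)
  else imgLen M.c M.d (hiEnd (i + 1)) (loEnd i)

lemma exists_piece (M : Moeb) {i j : ℕ} (h1 : 1 ≤ i) (hij : i ≤ j) (h4 : j ≤ 4)
    (h3 : i < j → 3 ≤ j) :
    ∃ n : Node, n.K ⊆ M.map '' Eset i j ∧
      n.lo = min (M.map (loEnd j)) (M.map (hiEnd i)) ∧
      n.hi = max (M.map (loEnd j)) (M.map (hiEnd i)) ∧ n.gap = pieceGap M i j := by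
  rcases hij.lt_or_eq with h | rfl
  · exact ⟨⟨M, i, j, h1, h, h3 h, h4⟩, Subset.rfl, rfl, rfl, by simp [pieceGap, gap, h.ne]⟩
  · have ht : 3 ≤ topDigit i ∧ topDigit i ≤ 4 := by
      unfold topDigit
      split_ifs <;> omega
    have e1 : (M.ext i h1).map (hiEnd 1) = M.map (loEnd i) := by
      rw [M.map_ext _ _ (hiEnd_nonneg 1), hiEnd_one, loEnd]
    have e2 : (M.ext i h1).map (loEnd (topDigit i)) = M.map (hiEnd i) := by
      rw [M.map_ext _ _ (loEnd_nonneg _), hiEnd]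
    refine ⟨⟨M.ext i h1, 1, topDigit i, le_refl 1, by omega, ht.1, ht.2⟩, ?_, ?_, ?_, ?_⟩
    · rintro _ ⟨x, hx, rfl⟩
      have hx0 := (loEnd_nonneg _).trans (Eset_subset (le_refl 1) hx).1
      exact ⟨_, one_div_add_mem_Eset h1 h4 hx, (M.map_ext i h1 hx0).symm⟩
    · rw [lo, e1, e2, min_comm]
    · rw [hi, e1, e2, max_comm]
    · simp [pieceGap, gap, Moeb.ext]

lemma K_nonempty (n : Node) : n.K.Nonempty :=
  (Eset_nonempty (by have := n.lt; have := n.le_four; omega) n.three_le).image _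

lemma K_subset (n : Node) : n.K ⊆ Icc n.lo n.hi := by
  rintro _ ⟨x, hx, rfl⟩
  obtain ⟨h1, h2⟩ := Eset_subset n.one_le hx
  exact n.M.map_mem (loEnd_nonneg _) h1 h2

lemma hi_sub_lo (n : Node) :
    n.hi - n.lo = imgLen n.M.c n.M.d (loEnd n.j) (hiEnd n.i) :=
  n.M.max_sub_min (loEnd_nonneg _) (loEnd_le_hiEnd n.one_le n.lt.le n.le_four)

lemma isCompact_K (n : Node) : IsCompact n.K :=
  (isCompact_Eset _ _).image_of_continuousOn (n.M.continuousOn_map.mono fun _ hx =>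
    (loEnd_nonneg _).trans (Eset_subset n.one_le hx).1)

lemma gap_bounds (n : Node) :
    hiEnd (n.i + 1) ≤ loEnd n.i ∧
    n.gap ≤ imgLen n.M.c n.M.d (loEnd n.j) (hiEnd (n.i + 1)) ∧
    n.gap ≤ imgLen n.M.c n.M.d (loEnd n.i) (hiEnd n.i) ∧
    pieceGap n.M n.i n.i ≤ n.gap ∧ pieceGap n.M (n.i + 1) n.j ≤ n.gap ∧
    1 / 25 * imgLen n.M.c n.M.d (loEnd n.j) (hiEnd n.i) ≤ n.gap := by
  obtain ⟨⟨a, b, c, d, hc, hd, hdc, -⟩, i, j, h1, hlt, h3, h4⟩ := n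
  have a1 := loEnd_one_mem
  have a2 := loEnd_two_mem
  have a3 := loEnd_three_mem
  have a4 := loEnd_four_mem
  have b1 := hiEnd_one_mem
  have b2 := hiEnd_two_mem
  have b3 := hiEnd_three_mem
  have b4 := hiEnd_four_mem
  have m1 := mul_nonneg hd hd
  have m2 := mul_nonneg hd (sub_nonneg.2 hdc)
  have m3 := mul_nonneg (sub_nonneg.2 hdc) (sub_nonneg.2 hdc)
  have p1 : 0 < c * 1 + d := by linarith
  have p2 : 0 < c * 2 + d := by linarith
  have p3 : 0 < c * 3 + d := by linarith
  have p4 : 0 < c * 4 + d := by linarith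
  have hcases : (i = 1 ∧ j = 3) ∨ (i = 1 ∧ j = 4) ∨ (i = 2 ∧ j = 3) ∨ (i = 2 ∧ j = 4) ∨
      (i = 3 ∧ j = 4) := by omega
  rcases hcases with ⟨rfl, rfl⟩ | ⟨rfl, rfl⟩ | ⟨rfl, rfl⟩ | ⟨rfl, rfl⟩ | ⟨rfl, rfl⟩ <;>
    simp only [gap, pieceGap, Nat.reduceAdd, Nat.reduceEqDiff, if_true, if_false, Nat.cast_one,
      Nat.cast_ofNat] <;>
    refine ⟨?_, ?_, ?_, ?_, ?_, ?_⟩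
  all_goals first
    | (rw [mem_Icc] at *; linarith)
    | (refine imgLen_le ?_ ?_ ?_ ?_ (by assumption) (by assumption) (by assumption)
        (by assumption) ?_ ?_ ?_ ?_ ?_ <;>
        first | assumption | exact hc.le | (norm_num; done) | nlinarith)
    | (refine mul_imgLen_le _ ?_ ?_ ?_ ?_ (by assumption) (by assumption) (by assumption)
        (by assumption) ?_ ?_ ?_ ?_ ?_ ?_ <;>
        first | assumption | (norm_num; done) | nlinarith)

lemma exists_split (n : Node) : ∃ l r : Node, l.K ⊆ n.K ∧ r.K ⊆ n.K ∧ l.lo = n.lo ∧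
    r.hi = n.hi ∧ r.lo - l.hi = n.gap ∧ n.gap ≤ l.hi - l.lo ∧ n.gap ≤ r.hi - r.lo ∧
    l.gap ≤ n.gap ∧ r.gap ≤ n.gap := by
  obtain ⟨g0, g1, g2, g3, g4, -⟩ := n.gap_bounds
  have n1 := n.one_le
  have n2 := n.lt
  have n3 := n.three_le
  have n4 := n.le_four
  obtain ⟨p, pK, plo, phi, pgap⟩ := exists_piece n.M n1 le_rfl (by omega) (by omega)
  obtain ⟨q, qK, qlo, qhi, qgap⟩ := exists_piece n.M (Nat.le_add_left 1 n.i) n2 n4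
    fun _ => n3
  replace pK : p.K ⊆ n.K := pK.trans (image_mono (Eset_mono le_rfl n2.le))
  replace qK : q.K ⊆ n.K := qK.trans (image_mono (Eset_mono (Nat.le_succ _) le_rfl))
  have l1 := loEnd_le_hiEnd (Nat.le_add_left 1 n.i) n2 n4
  have l2 := loEnd_le_hiEnd n1 le_rfl (n2.le.trans n4)
  have z := loEnd_nonneg n.j
  have plen := n.M.max_sub_min (z.trans (l1.trans g0)) l2
  have qlen := n.M.max_sub_min z l1
  rw [← plo, ← phi] at plen
  rw [← qlo, ← qhi] at qlen
  have e1 := n.M.map_sub z (z.trans l1)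
  have e2 := n.M.map_sub (z.trans l1) ((z.trans l1).trans g0)
  have e3 := n.M.map_sub ((z.trans l1).trans g0) (((z.trans l1).trans g0).trans l2)
  have k1 := n.M.imgLen_nonneg z l1
  have k2 := n.M.imgLen_nonneg (z.trans l1) g0
  have k3 := n.M.imgLen_nonneg ((z.trans l1).trans g0) l2
  rcases n.M.det with h | h
  · rw [h] at e1 e2 e3
    rw [min_eq_left (by linarith)] at plo qlo
    rw [max_eq_right (by linarith)] at phi qhi
    have nlo : n.lo = n.M.map (loEnd n.j) := min_eq_left (by linarith)
    have nhi : n.hi = n.M.map (hiEnd n.i) := max_eq_right (by linarith)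
    refine ⟨q, p, qK, pK, by linarith, by linarith, ?_, by linarith, by linarith, by linarith,
      by linarith⟩
    rw [gap]
    linarith
  · rw [h] at e1 e2 e3
    rw [min_eq_right (by linarith)] at plo qlo
    rw [max_eq_left (by linarith)] at phi qhi
    have nlo : n.lo = n.M.map (hiEnd n.i) := min_eq_right (by linarith)
    have nhi : n.hi = n.M.map (loEnd n.j) := max_eq_left (by linarith)
    refine ⟨p, q, pK, qK, by linarith, by linarith, ?_, by linarith, by linarith, by linarith,
      by linarith⟩
    rw [gap]
    linarith

lemma Icc_subset_add {n m : Node} (h1 : n.gap ≤ m.hi - m.lo) (h2 : m.gap ≤ n.hi - n.lo) :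
    Icc (n.lo + m.lo) (n.hi + m.hi) ⊆ n.K + m.K := by
  have h := Icc_subset_closure_add K lo hi gap (by norm_num : (0 : ℝ) < 1 / 25) K_nonempty
    K_subset exists_split (fun n => by
      rw [n.hi_sub_lo]
      exact n.gap_bounds.2.2.2.2.2) h1 h2
  rwa [(n.isCompact_K.add m.isCompact_K).isClosed.closure_eq] at h

end Node

lemma app_nil (θ : ℕ → ℕ) : app [] θ = θ := by
  funext n
  simp [app]

lemma app_cons (d : ℕ) (w : List ℕ) (θ : ℕ → ℕ) : app (d :: w) θ = consSeq d (app w θ) := by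
  funext n
  cases n <;> simp [app, consSeq]

lemma app_append (u v : List ℕ) (θ : ℕ → ℕ) : app (u ++ v) θ = app u (app v θ) := by
  induction u with
  | nil => rw [List.nil_append, app_nil]
  | cons d u ih => rw [List.cons_append, app_cons, app_cons, ih]

/-- The Möbius map `M` describes prepending the word `w`. -/
def Represents (w : List ℕ) (M : Moeb) : Prop :=
  ∀ θ, ValidSeq θ → cfVal (app w θ) = M.map (cfVal θ)

lemma Represents.append_singleton {w : List ℕ} {M : Moeb} (h : Represents w M) {d : ℕ}
    (hd : 1 ≤ d) (hd' : d ≤ 4) : Represents (w ++ [d]) (M.ext d hd) := by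
  intro θ hθ
  have h0 : (0 : ℝ) ≤ cfVal θ := le_trans (by norm_num) (cfVal_mem hθ).1
  rw [app_append, app_cons, app_nil, h _ (validSeq_consSeq hd hd' hθ), cfVal_consSeq hd hd' hθ,
    M.map_ext d hd h0]

lemma bW_succ (k : ℕ) : bW (k + 1) = bW k ++ [1] ++ [4] := by
  simp [bW, List.replicate_succ']

lemma exists_represents_bW (k : ℕ) :
    ∃ M : Moeb, M.b * M.c - M.a * M.d = 1 ∧ Represents (bW k) M := by
  induction k with
  | zero =>
    refine ⟨⟨0, 1, 1, 0, one_pos, le_rfl, zero_le_one, Or.inl (by norm_num)⟩, by norm_num,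
      fun θ _ => ?_⟩
    have : bW 0 = [] := rfl
    rw [this, app_nil]
    simp [Moeb.map]
  | succ k ih =>
    obtain ⟨M, hM, h⟩ := ih
    refine ⟨(M.ext 1 le_rfl).ext 4 (by norm_num), ?_, ?_⟩
    · simp only [Moeb.ext]
      linarith
    · rw [bW_succ]
      exact (h.append_singleton le_rfl (by norm_num)).append_singleton (by norm_num) le_rfl

/-- The node with first digits `1, 2, 3` below `M`. -/
def rootNode (M : Moeb) : Node := ⟨M, 1, 3, le_rfl, by norm_num, le_rfl, by norm_num⟩

lemma Represents.Kb_eq {w : List ℕ} {p : ℕ} {M : Moeb} (h : Represents (w ++ [p]) M)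
    (hp : p = 1 ∨ p = 2) : Kb (w ++ [p]) = (rootNode M).K := by
  ext x
  simp only [Kb, List.getLast?_concat, Option.some.injEq, forall_eq', Node.K, rootNode, Eset,
    mem_ofPred_eq, mem_image, exists_exists_and_eq_and]
  refine exists_congr fun θ => ⟨?_, ?_⟩
  · rintro ⟨hθ, hb, rfl⟩
    have hv := validSeq_of_mem_Dset hθ
    refine ⟨⟨hθ, (hv 0).1, ?_⟩, (h θ hv).symm⟩
    have := (hv 0).2
    simp only [badPairs, mem_insert_iff, mem_singleton_iff, Prod.mk.injEq] at hb
    omega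
  · rintro ⟨⟨hθ, -, h3⟩, rfl⟩
    refine ⟨hθ, ?_, (h θ (validSeq_of_mem_Dset hθ)).symm⟩
    simp only [badPairs, mem_insert_iff, mem_singleton_iff, Prod.mk.injEq]
    omega

lemma rootNode_lo_hi {M : Moeb} (hM : M.b * M.c - M.a * M.d = 1) :
    (rootNode M).lo = M.map (cfVal per31) ∧ (rootNode M).hi = M.map (cfVal per13) := by
  have h0 := loEnd_nonneg 3
  have h1 := loEnd_le_hiEnd le_rfl (by norm_num : 1 ≤ 3) (by norm_num)
  have h2 := M.map_sub h0 (h0.trans h1)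
  have h3 := M.imgLen_nonneg h0 h1
  rw [hM, one_mul] at h2
  rw [← loEnd_three, ← hiEnd_one]
  have h4 : M.map (loEnd 3) ≤ M.map (hiEnd 1) := by linarith
  exact ⟨min_eq_left h4, max_eq_right h4⟩

lemma rootNode_hi_sub_lo (M : Moeb) :
    (rootNode M).hi - (rootNode M).lo = imgLen M.c M.d (loEnd 3) (hiEnd 1) :=
  Node.hi_sub_lo _

/-- The gap and length comparisons between the three Cantor sets in terms of the denominator
`q + q' x` attached to the common prefix. -/
lemma imgLen_comparisons {q q' : ℝ} (hq : 0 < q) (hq' : 0 ≤ q') :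
    imgLen (6 * q + 5 * q') (5 * q + 4 * q') (hiEnd 2) (loEnd 1) ≤
      imgLen (9 * q + 7 * q') (5 * q + 4 * q') (loEnd 3) (hiEnd 1) ∧
    imgLen (11 * q + 9 * q') (6 * q + 5 * q') (hiEnd 2) (loEnd 1) ≤
      imgLen (9 * q + 7 * q') (5 * q + 4 * q') (loEnd 3) (hiEnd 1) ∧
    imgLen (17 * q + 14 * q') (6 * q + 5 * q') (hiEnd 2) (loEnd 1) ≤
      imgLen (9 * q + 7 * q') (5 * q + 4 * q') (loEnd 3) (hiEnd 1) ∧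
    imgLen (9 * q + 7 * q') (5 * q + 4 * q') (hiEnd 2) (loEnd 1) ≤
      imgLen (11 * q + 9 * q') (6 * q + 5 * q') (loEnd 3) (hiEnd 1) ∧
    imgLen (9 * q + 7 * q') (5 * q + 4 * q') (hiEnd 2) (loEnd 1) ≤
      imgLen (17 * q + 14 * q') (6 * q + 5 * q') (loEnd 3) (hiEnd 1) := by
  have m1 := mul_nonneg hq.le hq.le
  have m2 := mul_nonneg hq.le hq'
  have m3 := mul_nonneg hq' hq'
  refine ⟨?_, ?_, ?_, ?_, ?_⟩ <;>
    refine imgLen_le (by positivity) (by positivity) (by positivity) (by positivity)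
      hiEnd_two_mem loEnd_one_mem loEnd_three_mem hiEnd_one_mem (by norm_num) (by norm_num)
      (by norm_num) (by norm_num) ?_ <;>
    nlinarith

/-- For every `s ≥ 1`, `(K(b^s,1,1) ∪ K(b^s,1,2)) + K(c^s,1,1)` is the closed
interval
`[[0; b^s,1,1,\overline{3,1}] + [0; c^s,1,1,\overline{3,1}],
  [0; b^s,1,2,\overline{1,3}] + [0; c^s,1,1,\overline{1,3}]]`. -/
theorem sum_Kbs1p_Kcs11 (s : ℕ) (hs : 1 ≤ s) :
    (Kb (bW s ++ [1, 1]) ∪ Kb (bW s ++ [1, 2])) + Kb (cW s ++ [1, 1]) =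
      Set.Icc
        (cfVal (app (bW s ++ [1, 1]) per31) + cfVal (app (cW s ++ [1, 1]) per31))
        (cfVal (app (bW s ++ [1, 2]) per13) + cfVal (app (cW s ++ [1, 1]) per13)) := by
  obtain ⟨k, rfl⟩ := Nat.exists_eq_add_of_le' hs
  obtain ⟨M, hM, hR⟩ := exists_represents_bW k
  have h13 := validSeq_of_mem_Dset per13_mem
  have h31 := validSeq_of_mem_Dset per31_mem
  have hG : Represents (bW (k + 1) ++ [1])
      (((M.ext 1 le_rfl).ext 4 (by norm_num)).ext 1 le_rfl) := by
    rw [bW_succ]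
    exact ((hR.append_singleton le_rfl (by norm_num)).append_singleton (by norm_num)
      le_rfl).append_singleton le_rfl (by norm_num)
  set G := ((M.ext 1 le_rfl).ext 4 (by norm_num)).ext 1 le_rfl with hGdef
  have hGc : G.c = 6 * M.c + 5 * M.d := by
    simp only [hGdef, Moeb.ext]
    push_cast
    ring
  have hGd : G.d = 5 * M.c + 4 * M.d := by
    simp only [hGdef, Moeb.ext]
    push_cast
    ring
  have hGdet : G.b * G.c - G.a * G.d = -1 := by
    simp only [hGdef, Moeb.ext]
    linarith
  have hA1 := hG.append_singleton (d := 1) le_rfl (by norm_num)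
  have hA2 := hG.append_singleton (d := 2) (by norm_num) (by norm_num)
  have hA1det : (G.ext 1 le_rfl).b * (G.ext 1 le_rfl).c -
      (G.ext 1 le_rfl).a * (G.ext 1 le_rfl).d = 1 := by
    simp only [Moeb.ext]
    linarith
  have hA2det : (G.ext 2 (by norm_num)).b * (G.ext 2 (by norm_num)).c -
      (G.ext 2 (by norm_num)).a * (G.ext 2 (by norm_num)).d = 1 := by
    simp only [Moeb.ext]
    linarith
  have hB : Represents (bW k ++ [1] ++ [3] ++ [1] ++ [1])
      ((((M.ext 1 le_rfl).ext 3 (by norm_num)).ext 1 le_rfl).ext 1 le_rfl) :=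
    (((hR.append_singleton le_rfl (by norm_num)).append_singleton (by norm_num)
      (by norm_num)).append_singleton le_rfl (by norm_num)).append_singleton le_rfl (by norm_num)
  set B := (((M.ext 1 le_rfl).ext 3 (by norm_num)).ext 1 le_rfl).ext 1 le_rfl with hBdef
  have hBc : B.c = 9 * M.c + 7 * M.d := by
    simp only [hBdef, Moeb.ext]
    push_cast
    ring
  have hBd : B.d = 5 * M.c + 4 * M.d := by
    simp only [hBdef, Moeb.ext]
    push_cast
    ring
  have hBdet : B.b * B.c - B.a * B.d = 1 := by
    simp only [hBdef, Moeb.ext]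
    linarith
  have w1 : bW (k + 1) ++ [1, 1] = bW (k + 1) ++ [1] ++ [1] := by simp
  have w2 : bW (k + 1) ++ [1, 2] = bW (k + 1) ++ [1] ++ [2] := by simp
  have w3 : cW (k + 1) ++ [1, 1] = bW k ++ [1] ++ [3] ++ [1] ++ [1] := by simp [cW]
  rw [w1, w2, w3, hA1.Kb_eq (Or.inl rfl), hA2.Kb_eq (Or.inr rfl), hB.Kb_eq (Or.inl rfl),
    hA1 _ h31, hB _ h31, hA2 _ h13, hB _ h13]
  obtain ⟨A1lo, A1hi⟩ := rootNode_lo_hi hA1det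
  obtain ⟨A2lo, A2hi⟩ := rootNode_lo_hi hA2det
  obtain ⟨Blo, Bhi⟩ := rootNode_lo_hi hBdet
  have A1c : (G.ext 1 le_rfl).c = 11 * M.c + 9 * M.d := by
    simp only [hGdef, Moeb.ext]
    push_cast
    ring
  have A1d : (G.ext 1 le_rfl).d = 6 * M.c + 5 * M.d := hGc
  have A2c : (G.ext 2 (by norm_num)).c = 17 * M.c + 14 * M.d := by
    simp only [hGdef, Moeb.ext]
    push_cast
    ring
  have A2d : (G.ext 2 (by norm_num)).d = 6 * M.c + 5 * M.d := hGc
  have hmid : (G.ext 2 (by norm_num)).map (cfVal per31) - (G.ext 1 le_rfl).map (cfVal per13) =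
      imgLen G.c G.d (hiEnd 2) (loEnd 1) := by
    have h := G.map_sub (hiEnd_nonneg 2) (loEnd_nonneg 1)
    have e1 : (G.ext 1 le_rfl).map (cfVal per13) = G.map (loEnd 1) := by
      rw [← hiEnd_one, G.map_ext 1 le_rfl (hiEnd_nonneg 1), hiEnd_one, loEnd]
    have e2 : (G.ext 2 (by norm_num)).map (cfVal per31) = G.map (hiEnd 2) := by
      rw [← loEnd_three, G.map_ext 2 (by norm_num) (loEnd_nonneg 3)]
      rfl
    rw [hGdet] at h
    rw [e1, e2]
    linarith
  have hG0 : 0 ≤ imgLen G.c G.d (hiEnd 2) (loEnd 1) :=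
    G.imgLen_nonneg (hiEnd_nonneg 2) (hiEnd_two_mem.2.trans (le_trans (by norm_num)
      loEnd_one_mem.1))
  obtain ⟨c1, c2, c3, c4, c5⟩ := imgLen_comparisons M.c_pos M.d_nonneg
  have c1' : imgLen G.c G.d (hiEnd 2) (loEnd 1) ≤ (rootNode B).hi - (rootNode B).lo := by
    rw [rootNode_hi_sub_lo, hGc, hGd, hBc, hBd]
    exact c1
  rw [← A1c, ← A1d, ← hBc, ← hBd, ← rootNode_hi_sub_lo] at c2
  rw [← A2c, ← A2d, ← hBc, ← hBd, ← rootNode_hi_sub_lo] at c3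
  rw [← A1c, ← A1d, ← hBc, ← hBd, ← rootNode_hi_sub_lo] at c4
  rw [← A2c, ← A2d, ← hBc, ← hBd, ← rootNode_hi_sub_lo] at c5
  have s1 := Node.Icc_subset_add (n := rootNode (G.ext 1 le_rfl)) (m := rootNode B) c2 c4
  have s2 := Node.Icc_subset_add (n := rootNode (G.ext 2 (by norm_num))) (m := rootNode B) c3 c5
  have A1le : (rootNode (G.ext 1 le_rfl)).lo ≤ (rootNode (G.ext 1 le_rfl)).hi := min_le_max
  have A2le : (rootNode (G.ext 2 (by norm_num))).lo ≤ (rootNode (G.ext 2 (by norm_num))).hi :=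
    min_le_max
  rw [← A2lo, ← A1hi] at hmid
  rw [← A1lo, ← A2hi, ← Blo, ← Bhi]
  apply Subset.antisymm
  · rintro _ ⟨a, ha, b, hb, rfl⟩
    have hb' := Node.K_subset _ hb
    rw [mem_Icc] at hb' ⊢
    rcases ha with ha | ha <;>
    · have ha' := Node.K_subset _ ha
      rw [mem_Icc] at ha'
      constructor <;> linarith
  · rintro x ⟨hx1, hx2⟩
    rcases le_total x ((rootNode (G.ext 1 le_rfl)).hi + (rootNode B).hi) with h | h
    · exact Set.add_subset_add_right subset_union_left (s1 ⟨hx1, h⟩)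
    · exact Set.add_subset_add_right subset_union_right (s2 ⟨by linarith, hx2⟩)
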